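/- arXiv:1606.09507 — 5 statements merged into one kernel-verified Lean document; each statement's English description precedes it below -/
import Mathlib

section
/- Let n, r, s be positive integers with 1 ≤ s ≤ r, and let c : Fin n → Fin n → Fin r → Fin r → ℂ be Hermitian coefficients (c(k,j,μ,λ) = conj(c(j,k,λ,μ)) for all indices) whose associated form is Nakano nonnegative. Then the induced form on the s-th exterior power level is Nakano nonnegative: for every function t assigning a complex number t(j,L) to each j : Fin n and each strictly increasing tuple L : Fin s → Fin r, the sum Σ_{j,k : Fin n} Σ_{L,M strictly increasing} c^s(j,k,L,M)·t(j,L)·conj(t(k,M)) is a nonnegative real number. -/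
open Complex Finset
open scoped ComplexOrder

/-- The tuple obtained from `L : Fin s → α` by deleting its `l`-th entry. -/
def deleteAt {α : Type*} {s : ℕ} (L : Fin s → α) (l : Fin s) : Fin (s - 1) → α :=
  fun i => L (Fin.cast (Nat.succ_pred_eq_of_pos l.pos)
    ((Fin.cast (Nat.succ_pred_eq_of_pos l.pos).symm l).succAbove i))

/-- The induced curvature coefficients on the `s`-th exterior power level:
`c^s(j,k,L,M) = Σ_{(l,m) : deleting the l-th entry of L equals deleting the m-th entry of M}
(−1)^{l+m} c(j,k,L(l),M(m))`. -/
noncomputable def inducedCoeff {n r s : ℕ} (c : Fin n → Fin n → Fin r → Fin r → ℂ)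
    (j k : Fin n) (L M : Fin s → Fin r) : ℂ :=
  ∑ l : Fin s, ∑ m : Fin s,
    if deleteAt L l = deleteAt M m then
      (-1 : ℂ) ^ ((l : ℕ) + (m : ℕ)) * c j k (L l) (M m) else 0

noncomputable instance {r s : ℕ} : Fintype {L : Fin s → Fin r // StrictMono L} :=
  Fintype.ofFinite _

/-- A sesquilinear sum evaluated on vectors obtained by pushing forward along `v`. -/
theorem sum_mul_pushforward_mul_conj {ι κ : Type*} [Fintype ι] [Fintype κ] [DecidableEq κ]
    (c : κ → κ → ℂ) (v : ι → κ) (a b : ι → ℂ) :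
    ∑ x, ∑ y, c x y * (∑ i, if v i = x then a i else 0) *
        starRingEnd ℂ (∑ i, if v i = y then b i else 0) =
      ∑ i, ∑ i', c (v i) (v i') * a i * starRingEnd ℂ (b i') := by
  simp only [map_sum, Finset.mul_sum, Finset.sum_mul, apply_ite (starRingEnd ℂ), map_zero,
    mul_ite, ite_mul, mul_zero, zero_mul]
  calc _ = ∑ x, ∑ i', ∑ i, if v i = x then c x (v i') * a i * starRingEnd ℂ (b i') else 0 := by
        refine Finset.sum_congr rfl fun x _ => ?_
        rw [Finset.sum_comm]
        refine Finset.sum_congr rfl fun i' _ => ?_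
        simp
    _ = ∑ i', ∑ i, ∑ x, if v i = x then c x (v i') * a i * starRingEnd ℂ (b i') else 0 := by
        rw [Finset.sum_comm]
        exact Finset.sum_congr rfl fun i' _ => Finset.sum_comm
    _ = _ := by
        rw [Finset.sum_comm]
        simp

/-- If a Hermitian-type form is nonnegative, so is its pull-back along `v` restricted to the pairs
of indices on which `key` agrees. -/
theorem sum_ite_key_eq_nonneg {ν ι κ τ : Type*} [Fintype ν] [Fintype ι] [Fintype κ]
    [Fintype τ] [DecidableEq τ] (c : ν → ν → κ → κ → ℂ)
    (hpos : ∀ σ : ν → κ → ℂ,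
      0 ≤ ∑ j, ∑ k, ∑ x, ∑ y, c j k x y * σ j x * starRingEnd ℂ (σ k y))
    (v : ι → κ) (key : ι → τ) (u : ν → ι → ℂ) :
    0 ≤ ∑ j, ∑ k, ∑ i, ∑ i',
      if key i = key i' then c j k (v i) (v i') * u j i * starRingEnd ℂ (u k i') else 0 := by
  classical
  have h : 0 ≤ ∑ K : τ, ∑ j, ∑ k, ∑ i, ∑ i', c j k (v i) (v i') *
      (if key i = K then u j i else 0) * starRingEnd ℂ (if key i' = K then u k i' else 0) := by
    refine Finset.sum_nonneg fun K _ => ?_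
    refine (hpos fun j x => ∑ i, if v i = x then (if key i = K then u j i else 0) else 0).trans_eq
      (Finset.sum_congr rfl fun j _ => Finset.sum_congr rfl fun k _ => ?_)
    exact sum_mul_pushforward_mul_conj (c j k) v _ _
  refine h.trans_eq ?_
  rw [Finset.sum_comm]
  refine Finset.sum_congr rfl fun j _ => ?_
  rw [Finset.sum_comm]
  refine Finset.sum_congr rfl fun k _ => ?_
  rw [Finset.sum_comm]
  refine Finset.sum_congr rfl fun i _ => ?_
  rw [Finset.sum_comm]
  refine Finset.sum_congr rfl fun i' _ => ?_
  simp [apply_ite (starRingEnd ℂ), eq_comm]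

/-- Nakano nonnegativity is inherited by the `s`-th exterior power
(Lemma 3.1 of the paper, nonnegative case). -/
theorem inducedCoeff_nakano_nonneg (n r s : ℕ) (hn : 0 < n) (hr : 0 < r)
    (hs : 1 ≤ s) (hsr : s ≤ r)
    (c : Fin n → Fin n → Fin r → Fin r → ℂ)
    (hherm : ∀ j k lam mu, c k j mu lam = starRingEnd ℂ (c j k lam mu))
    (hpos : ∀ σ : Fin n → Fin r → ℂ,
      0 ≤ ∑ j : Fin n, ∑ k : Fin n, ∑ lam : Fin r, ∑ mu : Fin r,
        c j k lam mu * σ j lam * starRingEnd ℂ (σ k mu))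
    (t : Fin n → {L : Fin s → Fin r // StrictMono L} → ℂ) :
    0 ≤ ∑ j : Fin n, ∑ k : Fin n,
      ∑ L : {L : Fin s → Fin r // StrictMono L}, ∑ M : {M : Fin s → Fin r // StrictMono M},
        inducedCoeff c j k L.1 M.1 * t j L * starRingEnd ℂ (t k M) := by
  have h := sum_ite_key_eq_nonneg c hpos
    (fun p : {L : Fin s → Fin r // StrictMono L} × Fin s => p.1.1 p.2)
    (fun p => deleteAt p.1.1 p.2) (fun j p => (-1 : ℂ) ^ (p.2 : ℕ) * t j p.1)
  refine h.trans_eq ?_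
  refine Finset.sum_congr rfl fun j _ => Finset.sum_congr rfl fun k _ => ?_
  simp only [Fintype.sum_prod_type, inducedCoeff, Finset.sum_mul]
  refine Finset.sum_congr rfl fun L _ => ?_
  rw [Finset.sum_comm]
  refine Finset.sum_congr rfl fun M _ => Finset.sum_congr rfl fun l _ =>
    Finset.sum_congr rfl fun m _ => ?_
  split_ifs
  · simp only [map_mul, map_pow, map_neg, map_one]
    ring
  · simp
end

section
/- Let n, r, s be positive integers with 1 ≤ s ≤ r, and let c : Fin n → Fin n → Fin r → Fin r → ℂ be Hermitian coefficients (c(k,j,μ,λ) = conj(c(j,k,λ,μ)) for all indices) whose associated form is Nakano nonpositive. Then the induced form on the s-th exterior power level is Nakano nonpositive: for every function t assigning a complex number t(j,L) to each j : Fin n and each strictly increasing tuple L : Fin s → Fin r, the sum Σ_{j,k : Fin n} Σ_{L,M strictly increasing} c^s(j,k,L,M)·t(j,L)·conj(t(k,M)) is a nonpositive real number. -/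
open Complex Finset
open scoped ComplexOrder

/-- Reindexing a sesquilinear sum along a labelling `lab`: the coefficients on the right are
pulled back, the vectors on the left are pushed forward. -/
lemma sum_mul_pushforward {A Λ : Type*} [Fintype A] [Fintype Λ] [DecidableEq Λ]
    (c : Λ → Λ → ℂ) (lab : A → Λ) (v w : A → ℂ) :
    (∑ lam, ∑ mu, c lam mu * (∑ a, if lab a = lam then v a else 0) *
      starRingEnd ℂ (∑ b, if lab b = mu then w b else 0)) =
    ∑ a, ∑ b, c (lab a) (lab b) * v a * starRingEnd ℂ (w b) := by
  have inner (lam : Λ) : (∑ mu, c lam mu * (∑ a, if lab a = lam then v a else 0) *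
      starRingEnd ℂ (∑ b, if lab b = mu then w b else 0)) =
      ∑ b, c lam (lab b) * (∑ a, if lab a = lam then v a else 0) * starRingEnd ℂ (w b) := by
    simp_rw [map_sum, Finset.mul_sum]
    rw [Finset.sum_comm]
    refine Finset.sum_congr rfl fun b _ => ?_
    rw [Fintype.sum_eq_single (lab b) fun mu h => by simp [h.symm]]
    simp
  simp_rw [inner]
  rw [Finset.sum_comm]
  conv_rhs => rw [Finset.sum_comm]
  refine Finset.sum_congr rfl fun b _ => ?_
  simp_rw [Finset.mul_sum, Finset.sum_mul]
  rw [Finset.sum_comm]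
  refine Finset.sum_congr rfl fun a _ => ?_
  rw [Fintype.sum_eq_single (lab a) fun lam h => by simp [h.symm]]
  simp

/-- A Nakano nonpositive form stays nonpositive when its fibre index is pulled back along a
labelling `lab` and restricted to the pairs on which `key` agrees. -/
lemma sum_key_eq_nonpos {J Λ A K : Type*} [Fintype J] [Fintype Λ] [Fintype A] [Fintype K]
    [DecidableEq Λ] [DecidableEq K] (c : J → J → Λ → Λ → ℂ)
    (hneg : ∀ σ : J → Λ → ℂ,
      (∑ j, ∑ k, ∑ lam, ∑ mu, c j k lam mu * σ j lam * starRingEnd ℂ (σ k mu)) ≤ 0)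
    (lab : A → Λ) (key : A → K) (w : J → A → ℂ) :
    (∑ j, ∑ k, ∑ a, ∑ b, if key a = key b then
      c j k (lab a) (lab b) * w j a * starRingEnd ℂ (w k b) else 0) ≤ 0 := by
  have split : (∑ j, ∑ k, ∑ a, ∑ b, if key a = key b then
      c j k (lab a) (lab b) * w j a * starRingEnd ℂ (w k b) else 0) =
      ∑ x : K, ∑ j, ∑ k, ∑ a, ∑ b, c j k (lab a) (lab b) * (if key a = x then w j a else 0) *
        starRingEnd ℂ (if key b = x then w k b else 0) := by
    symm
    rw [Finset.sum_comm]
    refine Finset.sum_congr rfl fun j _ => ?_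
    rw [Finset.sum_comm]
    refine Finset.sum_congr rfl fun k _ => ?_
    rw [Finset.sum_comm]
    refine Finset.sum_congr rfl fun a _ => ?_
    rw [Finset.sum_comm]
    refine Finset.sum_congr rfl fun b _ => ?_
    rw [Fintype.sum_eq_single (key a) fun x h => by simp [h.symm]]
    by_cases h : key b = key a
    · simp [h]
    · simp [h, Ne.symm h]
  rw [split]
  refine Finset.sum_nonpos fun x _ => ?_
  have h := hneg fun j lam => ∑ a, if lab a = lam then (if key a = x then w j a else 0) else 0
  simpa only [sum_mul_pushforward] using h

/-- Nakano nonpositivity is inherited by the `s`-th exterior power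
(Lemma 3.1 of the paper, nonpositive case). -/
theorem inducedCoeff_nakano_nonpos (n r s : ℕ) (hn : 0 < n) (hr : 0 < r)
    (hs : 1 ≤ s) (hsr : s ≤ r)
    (c : Fin n → Fin n → Fin r → Fin r → ℂ)
    (hherm : ∀ j k lam mu, c k j mu lam = starRingEnd ℂ (c j k lam mu))
    (hneg : ∀ σ : Fin n → Fin r → ℂ,
      (∑ j : Fin n, ∑ k : Fin n, ∑ lam : Fin r, ∑ mu : Fin r,
        c j k lam mu * σ j lam * starRingEnd ℂ (σ k mu)) ≤ 0)
    (t : Fin n → {L : Fin s → Fin r // StrictMono L} → ℂ) :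
    (∑ j : Fin n, ∑ k : Fin n,
      ∑ L : {L : Fin s → Fin r // StrictMono L}, ∑ M : {M : Fin s → Fin r // StrictMono M},
        inducedCoeff c j k L.1 M.1 * t j L * starRingEnd ℂ (t k M)) ≤ 0 := by
  classical
  have h := sum_key_eq_nonpos c hneg
    (A := {L : Fin s → Fin r // StrictMono L} × Fin s)
    (fun a => a.1.1 a.2) (fun a => deleteAt a.1.1 a.2)
    (fun j a => (-1 : ℂ) ^ (a.2 : ℕ) * t j a.1)
  refine le_of_eq_of_le ?_ h
  refine Finset.sum_congr rfl fun j _ => Finset.sum_congr rfl fun k _ => ?_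
  simp_rw [Fintype.sum_prod_type]
  refine Finset.sum_congr rfl fun L _ => ?_
  rw [Finset.sum_comm]
  refine Finset.sum_congr rfl fun M _ => ?_
  simp_rw [inducedCoeff, Finset.sum_mul]
  refine Finset.sum_congr rfl fun l _ => Finset.sum_congr rfl fun m _ => ?_
  split_ifs
  · simp only [map_mul, map_pow, map_neg, map_one]
    ring
  · simp
end

section
/- Let n, r, s be positive integers with 1 ≤ s ≤ r and let c : Fin n → Fin n → Fin r → Fin r → ℂ. Let t assign a complex number t(j,L) to each j : Fin n and each strictly increasing tuple L : Fin s → Fin r, and let τ : Fin n → (Fin s → Fin r) → ℂ be the unique alternating extension of t. Then the induced form decomposes as a sum of copies of the original form evaluated on slices: Σ_{j,k : Fin n} Σ_{L,M strictly increasing} c^s(j,k,L,M)·t(j,L)·conj(t(k,M)) = Σ over strictly increasing tuples L' : Fin (s−1) → Fin r of Σ_{j,k : Fin n} Σ_{λ,μ : Fin r} c(j,k,λ,μ)·τ(j, λ::L')·conj(τ(k, μ::L')), where λ::L' denotes the s-tuple obtained by prepending λ to L' (Fin.cons). -/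
open Complex Finset
open scoped ComplexOrder

/-- The `s`-tuple obtained by prepending `a` to the `(s-1)`-tuple `L'` (`Fin.cons` up to the
cast `s = s - 1 + 1`). -/
def consCast {α : Type*} {s : ℕ} (hs : 1 ≤ s) (a : α) (L' : Fin (s - 1) → α) : Fin s → α :=
  fun i => (Fin.cons a L' : Fin (s - 1 + 1) → α) (Fin.cast (Nat.succ_pred_eq_of_pos hs).symm i)

theorem eq_and_eq_of_deleteAt_eq {r p : ℕ} {L M : Fin (p + 1) → Fin r} (hL : StrictMono L)
    (hM : StrictMono M) {l m : Fin (p + 1)} (hd : deleteAt L l = deleteAt M m)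
    (he : L l = M m) : L = M ∧ l = m := by
  have key : ∀ (K : Fin (p + 1) → Fin r) (i : Fin (p + 1)),
      Set.range K = insert (K i) (Set.range (deleteAt K i)) := by
    intro K i
    ext x
    constructor
    · rintro ⟨a, rfl⟩
      rcases Fin.eq_self_or_eq_succAbove i a with rfl | ⟨b, rfl⟩
      · exact Or.inl rfl
      · exact Or.inr ⟨b, rfl⟩
    · rintro (rfl | ⟨b, rfl⟩)
      · exact ⟨i, rfl⟩
      · exact ⟨i.succAbove b, rfl⟩
  have hLM : L = M := by
    rw [← hL.range_inj hM, key L l, key M m, hd, he]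
  subst hLM
  exact ⟨rfl, hL.injective he⟩

theorem strictMono_deleteAt {r p : ℕ} {L : Fin (p + 1) → Fin r} (hL : StrictMono L)
    (l : Fin (p + 1)) : StrictMono (deleteAt L l) :=
  hL.comp (Fin.strictMono_succAbove l)

/-- A strictly increasing tuple can be extended by any new entry. -/
theorem exists_strictMono_deleteAt_eq {r p : ℕ} {K : Fin p → Fin r} (hK : StrictMono K)
    {a : Fin r} (ha : a ∉ Set.range K) :
    ∃ L : Fin (p + 1) → Fin r, StrictMono L ∧ ∃ l, L l = a ∧ deleteAt L l = K := by
  classical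
  have hcard : (insert a (Finset.univ.image K)).card = p + 1 := by
    rw [Finset.card_insert_of_notMem (by simpa using ha),
      Finset.card_image_of_injective _ hK.injective, Finset.card_univ, Fintype.card_fin]
  set L := (insert a (Finset.univ.image K)).orderEmbOfFin hcard with hLdef
  have hr : Set.range L = insert a (Set.range K) := by
    rw [hLdef, Finset.range_orderEmbOfFin]
    simp
  obtain ⟨l, hl⟩ : a ∈ Set.range L := hr ▸ Set.mem_insert _ _
  refine ⟨L, L.strictMono, l, hl, ?_⟩
  have hd : StrictMono (deleteAt L l) := strictMono_deleteAt L.strictMono l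
  refine (StrictMono.range_inj hd hK).1 ?_
  ext x
  constructor
  · rintro ⟨i, rfl⟩
    have hx : L (l.succAbove i) ∈ insert a (Set.range K) := hr ▸ Set.mem_range_self _
    rcases hx with hx | hx
    · exact absurd (L.injective (hx.trans hl.symm)) (Fin.succAbove_ne l i)
    · exact hx
  · intro hx
    have hx' : x ∈ Set.range L := hr ▸ Set.mem_insert_of_mem _ hx
    obtain ⟨b, rfl⟩ := hx'
    rcases Fin.eq_self_or_eq_succAbove l b with rfl | ⟨i, rfl⟩
    · exact absurd (hl ▸ hx) ha
    · exact ⟨i, rfl⟩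

theorem cons_deleteAt_eq_comp {r p : ℕ} (L : Fin (p + 1) → Fin r) (l : Fin (p + 1)) :
    (Fin.cons (L l) (deleteAt L l) : Fin (p + 1) → Fin r) = L ∘ l.cycleRange.symm :=
  Fin.cons_removeNth_eq_comp_cycleRange_symm L l

/-- Contracting an alternating array against a slice, as a sum over increasing tuples. -/
theorem sum_mul_cons_eq {r p : ℕ} (T : (Fin (p + 1) → Fin r) → ℂ)
    (halt : ∀ (L : Fin (p + 1) → Fin r) (σ : Equiv.Perm (Fin (p + 1))),
      T (L ∘ σ) = ((Equiv.Perm.sign σ : ℤ) : ℂ) * T L)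
    (hzero : ∀ L : Fin (p + 1) → Fin r, ¬ Function.Injective L → T L = 0)
    {K : Fin p → Fin r} (hK : StrictMono K) (g : Fin r → ℂ) :
    ∑ a, g a * T (Fin.cons a K) =
      ∑ L : {L : Fin (p + 1) → Fin r // StrictMono L}, ∑ l : Fin (p + 1),
        if deleteAt L.1 l = K then (-1 : ℂ) ^ (l : ℕ) * g (L.1 l) * T L.1 else 0 := by
  classical
  rw [← Fintype.sum_prod_type', ← Finset.sum_filter]
  symm
  have hvanish : ∑ a, g a * T (Fin.cons a K) =
      ∑ a ∈ Finset.univ.filter (fun a => a ∉ Set.range K), g a * T (Fin.cons a K) := by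
    rw [Finset.sum_filter_of_ne]
    intro a _ hne ha
    apply hne
    rw [hzero _ (fun h => (Fin.cons_injective_iff.1 h).1 ha), mul_zero]
  rw [hvanish]
  refine Finset.sum_bij (fun x _ => x.1.1 x.2) ?_ ?_ ?_ ?_
  · rintro ⟨⟨L, hL⟩, l⟩ hx
    obtain rfl : deleteAt L l = K := by simpa using hx
    simp only [Finset.mem_filter, Finset.mem_univ, true_and]
    rintro ⟨i, hi⟩
    exact Fin.succAbove_ne l i (hL.injective hi)
  · rintro ⟨⟨L, hL⟩, l⟩ hx ⟨⟨M, hM⟩, m⟩ hy he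
    have hx : deleteAt L l = K := by simpa using hx
    have hy : deleteAt M m = K := by simpa using hy
    obtain ⟨rfl, rfl⟩ := eq_and_eq_of_deleteAt_eq hL hM (hx.trans hy.symm) he
    rfl
  · intro a ha
    obtain ⟨L, hL, l, hl, hd⟩ := exists_strictMono_deleteAt_eq hK (Finset.mem_filter.1 ha).2
    exact ⟨(⟨L, hL⟩, l), by simpa using hd, hl⟩
  · rintro ⟨⟨L, hL⟩, l⟩ hx
    obtain rfl : deleteAt L l = K := by simpa using hx
    have h := halt L l.cycleRange.symm
    rw [← cons_deleteAt_eq_comp, Equiv.Perm.sign_symm, Fin.sign_cycleRange] at h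
    simp only [h]
    push_cast
    ring

theorem sum_inducedCoeff_eq {n r p : ℕ} (c : Fin n → Fin n → Fin r → Fin r → ℂ) (j k : Fin n)
    (S T : (Fin (p + 1) → Fin r) → ℂ)
    (hS : ∀ (L : Fin (p + 1) → Fin r) (σ : Equiv.Perm (Fin (p + 1))),
      S (L ∘ σ) = ((Equiv.Perm.sign σ : ℤ) : ℂ) * S L)
    (hS0 : ∀ L : Fin (p + 1) → Fin r, ¬ Function.Injective L → S L = 0)
    (hT : ∀ (L : Fin (p + 1) → Fin r) (σ : Equiv.Perm (Fin (p + 1))),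
      T (L ∘ σ) = ((Equiv.Perm.sign σ : ℤ) : ℂ) * T L)
    (hT0 : ∀ L : Fin (p + 1) → Fin r, ¬ Function.Injective L → T L = 0) :
    ∑ L : {L : Fin (p + 1) → Fin r // StrictMono L},
      ∑ M : {M : Fin (p + 1) → Fin r // StrictMono M},
        inducedCoeff c j k L.1 M.1 * S L.1 * T M.1 =
    ∑ K : {K : Fin p → Fin r // StrictMono K}, ∑ a, ∑ b,
      c j k a b * S (Fin.cons a K.1) * T (Fin.cons b K.1) := by
  classical
  have hslice : ∀ K : {K : Fin p → Fin r // StrictMono K},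
      ∑ a, ∑ b, c j k a b * S (Fin.cons a K.1) * T (Fin.cons b K.1) =
      ∑ L : {L : Fin (p + 1) → Fin r // StrictMono L},
        ∑ M : {M : Fin (p + 1) → Fin r // StrictMono M},
        ∑ l : Fin (p + 1), ∑ m : Fin (p + 1),
          if K = ⟨deleteAt L.1 l, strictMono_deleteAt L.2 l⟩ then
            (if deleteAt L.1 l = deleteAt M.1 m then
              (-1 : ℂ) ^ ((l : ℕ) + (m : ℕ)) * c j k (L.1 l) (M.1 m) else 0) * S L.1 * T M.1
          else 0 := by
    rintro ⟨K, hK⟩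
    have h1 : ∀ a, ∑ b, c j k a b * S (Fin.cons a K) * T (Fin.cons b K) =
        (∑ b, c j k a b * T (Fin.cons b K)) * S (Fin.cons a K) := by
      intro a
      rw [Finset.sum_mul]
      exact Finset.sum_congr rfl fun b _ => by ring
    simp only [h1]
    rw [sum_mul_cons_eq S hS hS0 hK]
    refine Finset.sum_congr rfl fun L _ => ?_
    rw [Finset.sum_comm]
    refine Finset.sum_congr rfl fun l _ => ?_
    by_cases h : deleteAt L.1 l = K
    · subst h
      simp only [if_true]
      rw [sum_mul_cons_eq T hT hT0 hK, Finset.mul_sum, Finset.sum_mul]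
      refine Finset.sum_congr rfl fun M _ => ?_
      rw [Finset.mul_sum, Finset.sum_mul]
      refine Finset.sum_congr rfl fun m _ => ?_
      by_cases h' : deleteAt M.1 m = deleteAt L.1 l
      · rw [if_pos h', if_pos h'.symm]
        ring
      · rw [if_neg h', if_neg (Ne.symm h')]
        ring
    · rw [if_neg h]
      simp [Subtype.ext_iff, Ne.symm h]
  simp only [hslice]
  symm
  rw [Finset.sum_comm]
  refine Finset.sum_congr rfl fun L _ => ?_
  rw [Finset.sum_comm]
  refine Finset.sum_congr rfl fun M _ => ?_
  rw [Finset.sum_comm, inducedCoeff, Finset.sum_mul, Finset.sum_mul]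
  refine Finset.sum_congr rfl fun l _ => ?_
  rw [Finset.sum_comm, Finset.sum_mul, Finset.sum_mul]
  refine Finset.sum_congr rfl fun m _ => ?_
  simp only [Finset.sum_ite_eq', Finset.mem_univ, if_true]

/-- Equation (e1) in the proof of the paper's Lemma 3.1:
`θ_{Λ^s E}(τ,τ) = Σ_{L'} θ_E(τ_{L'},τ_{L'})`. -/
theorem inducedCoeff_decomposition (n r s : ℕ) (hn : 0 < n) (hr : 0 < r)
    (hs : 1 ≤ s) (hsr : s ≤ r)
    (c : Fin n → Fin n → Fin r → Fin r → ℂ)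
    (t : Fin n → {L : Fin s → Fin r // StrictMono L} → ℂ)
    (τ : Fin n → (Fin s → Fin r) → ℂ)
    (halt : ∀ (j : Fin n) (L : Fin s → Fin r) (σ : Equiv.Perm (Fin s)),
      τ j (L ∘ σ) = ((Equiv.Perm.sign σ : ℤ) : ℂ) * τ j L)
    (hzero : ∀ (j : Fin n) (L : Fin s → Fin r), ¬ Function.Injective L → τ j L = 0)
    (hext : ∀ (j : Fin n) (L : {L : Fin s → Fin r // StrictMono L}), τ j L.1 = t j L) :
    (∑ j : Fin n, ∑ k : Fin n,
      ∑ L : {L : Fin s → Fin r // StrictMono L}, ∑ M : {M : Fin s → Fin r // StrictMono M},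
        inducedCoeff c j k L.1 M.1 * t j L * starRingEnd ℂ (t k M))
    = ∑ L' : {L' : Fin (s - 1) → Fin r // StrictMono L'},
        ∑ j : Fin n, ∑ k : Fin n, ∑ lam : Fin r, ∑ mu : Fin r,
          c j k lam mu * τ j (consCast hs lam L'.1)
            * starRingEnd ℂ (τ k (consCast hs mu L'.1)) := by
  obtain ⟨p, rfl⟩ : ∃ p, s = p + 1 := ⟨s - 1, by omega⟩
  rw [Finset.sum_comm (s := (Finset.univ : Finset {L' : Fin (p + 1 - 1) → Fin r // StrictMono L'}))]
  refine Finset.sum_congr rfl fun j _ => ?_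
  rw [Finset.sum_comm (s := (Finset.univ : Finset {L' : Fin (p + 1 - 1) → Fin r // StrictMono L'}))]
  refine Finset.sum_congr rfl fun k _ => ?_
  simp only [← hext]
  refine sum_inducedCoeff_eq c j k (τ j) (fun L => starRingEnd ℂ (τ k L)) (halt j) (hzero j)
    (fun L σ => ?_) (fun L hL => ?_)
  · rw [halt k L σ, map_mul, map_intCast]
  · rw [hzero k L hL, map_zero]
end

section
/- Let K be a field, let V be a finite-dimensional K-vector space with dim V = n, let f : V → V be a K-linear endomorphism, and let s be an integer with 1 ≤ s ≤ n. Then the determinant of the induced endomorphism Λ^s f of the s-th exterior power Λ^s V satisfies det(Λ^s f) = (det f)^C(n−1, s−1), where C(n−1, s−1) is the binomial coefficient (n−1 choose s−1). -/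
open ExteriorAlgebra

/-- `ExteriorAlgebra.map f` maps the `s`-th exterior power into itself. -/
theorem map_mem_exteriorPower {R M : Type*} [CommRing R] [AddCommGroup M] [Module R M]
    (s : ℕ) (f : M →ₗ[R] M) (x : ExteriorAlgebra R M) (hx : x ∈ ⋀[R]^s M) :
    ExteriorAlgebra.map f x ∈ ⋀[R]^s M := by
  rw [← ExteriorAlgebra.ιMulti_span_fixedDegree] at hx ⊢
  induction hx using Submodule.span_induction with
  | mem y hy =>
      obtain ⟨m, rfl⟩ := hy
      rw [ExteriorAlgebra.map_apply_ιMulti]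
      exact Submodule.subset_span ⟨f ∘ m, rfl⟩
  | zero => simp
  | add a b _ _ ha hb => rw [map_add]; exact Submodule.add_mem _ ha hb
  | smul r a _ ha => rw [map_smul]; exact Submodule.smul_mem _ _ ha

/-- The endomorphism `Λ^s f` of the `s`-th exterior power induced by an endomorphism `f`,
determined by `Λ^s f (v₁ ∧ … ∧ v_s) = f v₁ ∧ … ∧ f v_s`. -/
noncomputable def exteriorPowerMap {R M : Type*} [CommRing R] [AddCommGroup M] [Module R M]
    (s : ℕ) (f : M →ₗ[R] M) : ⋀[R]^s M →ₗ[R] ⋀[R]^s M :=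
  (ExteriorAlgebra.map f).toLinearMap.restrict (map_mem_exteriorPower s f)

/-- The endomorphism `exteriorPowerMap s f` is Mathlib's functorial map on exterior powers. -/
theorem exteriorPowerMap_eq_map {R M : Type*} [CommRing R] [AddCommGroup M] [Module R M]
    (s : ℕ) (f : M →ₗ[R] M) : exteriorPowerMap s f = exteriorPower.map s f := by
  apply exteriorPower.linearMap_ext
  ext m
  simp only [LinearMap.compAlternatingMap_apply, exteriorPower.map_apply_ιMulti]
  exact ExteriorAlgebra.map_apply_ιMulti f m

/-- A unipotent endomorphism of a finite free module over a domain has determinant one. -/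
theorem LinearMap.det_eq_one_of_isNilpotent_one_sub {R M : Type*} [CommRing R] [IsDomain R]
    [AddCommGroup M] [Module R M] [Module.Finite R M] [Module.Free R M] {f : Module.End R M}
    (hf : IsNilpotent (1 - f)) : LinearMap.det f = 1 := by
  have h := LinearMap.eval_charpoly (1 - f) 1
  rw [hf.charpoly_eq_X_pow_finrank] at h
  simpa using h.symm

/-- The product over all `s`-element subsets `t` of `∏ i ∈ t, d i`. -/
theorem Finset.prod_powersetCard_univ_prod {ι A : Type*} [Fintype ι] [CommMonoid A]
    (d : ι → A) {s : ℕ} (hs : 1 ≤ s) :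
    ∏ t ∈ Finset.powersetCard s (Finset.univ : Finset ι), ∏ i ∈ t, d i =
      (∏ i, d i) ^ Nat.choose (Fintype.card ι - 1) (s - 1) := by
  classical
  rw [Finset.prod_comm' (t' := Finset.univ)
    (s' := fun i => (Finset.powersetCard s Finset.univ).filter ({i} ⊆ ·)) (by simp),
    ← Finset.prod_pow]
  refine Finset.prod_congr rfl fun i _ => ?_
  rw [Finset.prod_const, Finset.card_filter_powersetCard_subset _ _ _ (Finset.subset_univ _)
    (by simpa using hs)]
  simp

namespace exteriorPower

open Module Set Set.powersetCard Matrix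

variable {ι : Type*} [Fintype ι] [LinearOrder ι]

theorem det_map_toLin_diagonal {R M : Type*} [CommRing R] [AddCommGroup M] [Module R M]
    (b : Basis ι R M) (d : ι → R) {s : ℕ} (hs : 1 ≤ s) :
    LinearMap.det (exteriorPower.map s (Matrix.toLin b b (Matrix.diagonal d))) =
      (∏ i, d i) ^ Nat.choose (Fintype.card ι - 1) (s - 1) := by
  classical
  have hb (i : ι) : Matrix.toLin b b (Matrix.diagonal d) (b i) = d i • b i := by
    simp [Matrix.toLin_self, Matrix.diagonal_apply, ite_smul]
  have key (S : powersetCard ι s) :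
      exteriorPower.map s (Matrix.toLin b b (Matrix.diagonal d)) (b.exteriorPower s S) =
        (∏ i ∈ (S : Finset ι), d i) • b.exteriorPower s S := by
    have hcomp : (Matrix.toLin b b (Matrix.diagonal d)) ∘ b ∘ (ofFinEmbEquiv.symm S) =
        fun k => d (ofFinEmbEquiv.symm S k) • (b ∘ (ofFinEmbEquiv.symm S)) k := by
      ext k
      exact hb _
    have hprod : ∏ i ∈ (S : Finset ι), d i = ∏ k, d (ofFinEmbEquiv.symm S k) := by
      have hS : (S : Finset ι) = Finset.univ.map (ofFinEmbEquiv.symm S).toEmbedding := by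
        ext i
        rw [mem_coe_iff, ← mem_range_ofFinEmbEquiv_symm_iff_mem]
        simp
      conv_lhs => rw [hS]
      simp
    rw [basis_apply, ιMulti_family, map_apply_ιMulti, hcomp, AlternatingMap.map_smul_univ, hprod]
  have hmat : LinearMap.toMatrix (b.exteriorPower s) (b.exteriorPower s)
      (exteriorPower.map s (Matrix.toLin b b (Matrix.diagonal d))) =
        Matrix.diagonal fun S : powersetCard ι s => ∏ i ∈ (S : Finset ι), d i := by
    ext S T
    rw [LinearMap.toMatrix_apply, key, map_smul, Basis.repr_self, Matrix.diagonal_apply]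
    by_cases h : S = T
    · subst h; simp
    · simp [h]
  rw [← LinearMap.det_toMatrix (b.exteriorPower s), hmat, Matrix.det_diagonal,
    ← Finset.prod_powersetCard_univ_prod d hs]
  exact (Finset.prod_subtype _ (by simp) (fun t : Finset ι => ∏ i ∈ t, d i)).symm

theorem det_map_toLin_transvection {R M : Type*} [CommRing R] [IsDomain R] [AddCommGroup M]
    [Module R M] (b : Basis ι R M) {i j : ι} (hij : i ≠ j) (c : R) (s : ℕ) :
    LinearMap.det (exteriorPower.map s (Matrix.toLin b b (Matrix.transvection i j c))) = 1 := by
  classical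
  have := Module.Finite.of_basis b
  have := Module.Free.of_basis b
  set T := Matrix.toLin b b (Matrix.transvection i j c) with hT
  have hTj : T (b j) = b j + c • b i := by
    simp [hT, Matrix.transvection, Matrix.toLin_self, Matrix.single_apply, ite_smul]
  have hTk (k : ι) (hk : k ≠ j) : T (b k) = b k := by
    simp [hT, Matrix.transvection, Matrix.toLin_self, hk.symm]
  have hfix (v : Fin s → M) (hv : ∀ k, T (v k) = v k) :
      exteriorPower.map s T (ιMulti R s v) = ιMulti R s v := by
    rw [map_apply_ιMulti]
    congr 1
    ext k
    exact hv k
  apply LinearMap.det_eq_one_of_isNilpotent_one_sub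
  refine ⟨2, (b.exteriorPower s).ext fun S => ?_⟩
  rw [basis_apply, ιMulti_family, pow_two, Module.End.mul_apply, LinearMap.zero_apply]
  set σ := ofFinEmbEquiv.symm S
  by_cases hσ : ∃ k, σ k = j
  · obtain ⟨k, hk⟩ := hσ
    have hne (l : Fin s) (hl : l ≠ k) : σ l ≠ j := fun h => hl (σ.injective (h.trans hk.symm))
    have hcomp : T ∘ b ∘ σ = Function.update (b ∘ σ) k (b j + c • b i) := by
      ext l
      by_cases hl : l = k
      · subst hl; simp [hk, hTj]
      · simp [hl, hTk _ (hne l hl)]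
    have hself : Function.update (b ∘ σ) k (b j) = b ∘ σ := by
      rw [← hk]; exact Function.update_eq_self k (b ∘ σ)
    have hmap : exteriorPower.map s T (ιMulti R s (b ∘ σ)) =
        ιMulti R s (b ∘ σ) + c • ιMulti R s (Function.update (b ∘ σ) k (b i)) := by
      rw [map_apply_ιMulti, hcomp, AlternatingMap.map_update_add, AlternatingMap.map_update_smul,
        hself]
    have hupd := hfix (Function.update (b ∘ σ) k (b i)) fun l => by
      by_cases hl : l = k
      · subst hl; simp [hTk i hij]
      · simp [hl, hTk _ (hne l hl)]
    simp [LinearMap.sub_apply, hmap, hupd]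
  · push Not at hσ
    simp [LinearMap.sub_apply, hfix (b ∘ σ) fun k => hTk _ (hσ k)]

/-- The Sylvester–Franke identity for an endomorphism given by a matrix in a basis. -/
theorem det_map_toLin {K V : Type*} [Field K] [AddCommGroup V] [Module K V]
    (b : Basis ι K V) (A : Matrix ι ι K) {s : ℕ} (hs : 1 ≤ s) :
    LinearMap.det (exteriorPower.map s (Matrix.toLin b b A)) =
      A.det ^ Nat.choose (Fintype.card ι - 1) (s - 1) := by
  induction A using Matrix.diagonal_transvection_induction with
  | hdiag d _ => rw [det_map_toLin_diagonal b d hs, Matrix.det_diagonal]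
  | htransvec t =>
    rw [t.det, one_pow]
    exact det_map_toLin_transvection b t.hij t.c s
  | hmul A B hA hB =>
    rw [Matrix.toLin_mul b b b, exteriorPower.map_comp, LinearMap.det_comp, hA, hB,
      Matrix.det_mul, mul_pow]

end exteriorPower

/-- Sylvester–Franke identity: `det (Λ^s f) = (det f)^(n−1 choose s−1)` for an endomorphism `f`
of an `n`-dimensional vector space (identity (id) in the paper). -/
theorem det_exteriorPowerMap (K : Type*) [Field K] (V : Type*) [AddCommGroup V] [Module K V]
    [FiniteDimensional K V] (n : ℕ) (hn : Module.finrank K V = n)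
    (f : V →ₗ[K] V) (s : ℕ) (hs : 1 ≤ s) (hsn : s ≤ n) :
    LinearMap.det (exteriorPowerMap s f) = (LinearMap.det f) ^ Nat.choose (n - 1) (s - 1) := by
  have h := exteriorPower.det_map_toLin (Module.finBasisOfFinrankEq K V hn)
    (LinearMap.toMatrix (Module.finBasisOfFinrankEq K V hn) (Module.finBasisOfFinrankEq K V hn) f)
    hs
  rwa [Matrix.toLin_toMatrix, LinearMap.det_toMatrix, Fintype.card_fin,
    ← exteriorPowerMap_eq_map] at h
end

section
/- Let A be an n×n matrix over a commutative ring (in particular over ℂ) and let s be an integer with 1 ≤ s ≤ n. Then the determinant of the s-th compound matrix of A equals (det A)^C(n−1, s−1), where C(n−1, s−1) is the binomial coefficient (n−1 choose s−1). -/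
open Finset

/-- The `s`-th compound matrix of `H`: the matrix indexed by strictly increasing `s`-tuples,
whose `(L,M)`-entry is the determinant of the `s×s` submatrix of `H` formed by the rows `L`
and the columns `M`. -/
noncomputable def compound {R : Type*} [CommRing R] {r : ℕ} (s : ℕ)
    (H : Matrix (Fin r) (Fin r) R) :
    Matrix {L : Fin s → Fin r // StrictMono L} {M : Fin s → Fin r // StrictMono M} R :=
  fun L M => (H.submatrix L.1 M.1).det

open Matrix

/-- Strictly increasing `s`-tuples correspond to `s`-element subsets. -/
noncomputable def strictMonoEquivPowersetCard (r s : ℕ) :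
    {L : Fin s → Fin r // StrictMono L} ≃ Set.powersetCard (Fin r) s :=
  (Equiv.mk (fun L => OrderEmbedding.ofStrictMono L.1 L.2) (fun f => ⟨f, f.strictMono⟩)
    (fun _ => rfl) (fun _ => rfl)).trans Set.powersetCard.ofFinEmbEquiv

theorem ofFinEmbEquiv_symm_strictMonoEquivPowersetCard {r s : ℕ}
    (L : {L : Fin s → Fin r // StrictMono L}) :
    ⇑(Set.powersetCard.ofFinEmbEquiv.symm (strictMonoEquivPowersetCard r s L)) = L.1 := by
  rw [strictMonoEquivPowersetCard, Equiv.trans_apply, Equiv.symm_apply_apply]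
  rfl

theorem mem_strictMonoEquivPowersetCard {r s : ℕ}
    (L : {L : Fin s → Fin r // StrictMono L}) (j : Fin r) :
    j ∈ (strictMonoEquivPowersetCard r s L).1 ↔ j ∈ Set.range L.1 :=
  Set.powersetCard.mem_ofFinEmbEquiv_iff_mem_range _ _

section CommRing

variable {R : Type*} [CommRing R] {n : ℕ} (s : ℕ)

theorem compound_eq_toMatrix_exteriorPower_map (A : Matrix (Fin n) (Fin n) R) :
    compound s A =
      LinearMap.toMatrix
        (((Pi.basisFun R (Fin n)).exteriorPower s).reindex (strictMonoEquivPowersetCard n s).symm)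
        (((Pi.basisFun R (Fin n)).exteriorPower s).reindex (strictMonoEquivPowersetCard n s).symm)
        (exteriorPower.map s (toLin' A)) := by
  ext L M
  rw [LinearMap.toMatrix_apply, Module.Basis.repr_reindex_apply, Module.Basis.reindex_apply,
    Equiv.symm_symm, exteriorPower.basis_apply, exteriorPower.basis_repr_apply,
    exteriorPower.map_apply_ιMulti_family, exteriorPower.ιMulti_family,
    exteriorPower.ιMultiDual_apply_ιMulti, compound, ← det_transpose]
  congr 1
  ext i j
  simp [ofFinEmbEquiv_symm_strictMonoEquivPowersetCard]

/-- The Cauchy–Binet formula: compound matrices are multiplicative. -/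
theorem compound_mul (A B : Matrix (Fin n) (Fin n) R) :
    compound s (A * B) = compound s A * compound s B := by
  simp only [compound_eq_toMatrix_exteriorPower_map]
  rw [← LinearMap.toMatrix_comp, toLin'_mul, exteriorPower.map_comp]

theorem compound_one : compound s (1 : Matrix (Fin n) (Fin n) R) = 1 := by
  rw [compound_eq_toMatrix_exteriorPower_map, toLin'_one, exteriorPower.map_id,
    LinearMap.toMatrix_id]

theorem compound_map {S : Type*} [CommRing S] (f : R →+* S) (A : Matrix (Fin n) (Fin n) R) :
    compound s (A.map f) = (compound s A).map f := by
  ext L M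
  simp [compound, RingHom.map_det, submatrix_map]

theorem compound_diagonal (d : Fin n → R) :
    compound s (diagonal d) = diagonal fun L => ∏ i, d (L.1 i) := by
  ext L M
  by_cases h : L = M
  · subst h
    rw [compound, submatrix_diagonal _ _ L.2.injective, det_diagonal, diagonal_apply_eq]
    rfl
  · have hne : strictMonoEquivPowersetCard n s L ≠ strictMonoEquivPowersetCard n s M :=
      (strictMonoEquivPowersetCard n s).injective.ne h
    obtain ⟨j, hL, hM⟩ := (Set.powersetCard.exists_mem_notMem_iff_ne _ _).mp hne
    obtain ⟨i, rfl⟩ := (mem_strictMonoEquivPowersetCard L j).mp hL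
    rw [diagonal_apply_ne _ h]
    refine det_eq_zero_of_row_eq_zero i fun k => diagonal_apply_ne _ fun hk => hM ?_
    exact (mem_strictMonoEquivPowersetCard M _).mpr ⟨k, hk.symm⟩

end CommRing

theorem card_filter_mem_powersetCard_univ {n s : ℕ} (hs : 1 ≤ s) (j : Fin n) :
    #{S ∈ powersetCard s (univ : Finset (Fin n)) | j ∈ S} = (n - 1).choose (s - 1) := by
  have hnot : {S ∈ powersetCard s (univ : Finset (Fin n)) | j ∉ S} =
      powersetCard s (univ.erase j) := by
    ext S
    simp only [mem_filter, mem_powersetCard, subset_erase, subset_univ, true_and]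
    tauto
  have hcard := card_filter_add_card_filter_not (s := powersetCard s (univ : Finset (Fin n)))
    (fun S => j ∈ S)
  rw [hnot, card_powersetCard, card_powersetCard, card_erase_of_mem (mem_univ j), card_univ,
    Fintype.card_fin] at hcard
  obtain ⟨m, rfl⟩ : ∃ m, n = m + 1 := ⟨n - 1, by have := j.pos; omega⟩
  obtain ⟨t, rfl⟩ : ∃ t, s = t + 1 := ⟨s - 1, by omega⟩
  rw [Nat.choose_succ_succ] at hcard
  simpa using hcard

theorem prod_strictMono_prod {R : Type*} [CommMonoid R] {n s : ℕ} (hs : 1 ≤ s) (d : Fin n → R) :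
    ∏ L : {L : Fin s → Fin n // StrictMono L}, ∏ i, d (L.1 i) =
      (∏ j, d j) ^ (n - 1).choose (s - 1) := by
  have hL (L : {L : Fin s → Fin n // StrictMono L}) :
      ∏ i, d (L.1 i) = ∏ j ∈ (strictMonoEquivPowersetCard n s L).1, d j := by
    refine (prod_map univ ⟨L.1, L.2.injective⟩ d).symm.trans (congrArg (fun S => ∏ j ∈ S, d j) ?_)
    ext j
    simp [mem_strictMonoEquivPowersetCard]
  have hS : ∏ L : {L : Fin s → Fin n // StrictMono L},
      ∏ j ∈ (strictMonoEquivPowersetCard n s L).1, d j =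
      ∏ S ∈ powersetCard s (univ : Finset (Fin n)), ∏ j ∈ S, d j := by
    refine prod_bij (fun L _ => (strictMonoEquivPowersetCard n s L).1) (fun L _ => ?_)
      (fun L _ M _ h => (strictMonoEquivPowersetCard n s).injective (Subtype.ext h))
      (fun S hS => ?_) (fun _ _ => rfl)
    · exact mem_powersetCard.mpr ⟨subset_univ _, (strictMonoEquivPowersetCard n s L).2⟩
    · exact ⟨(strictMonoEquivPowersetCard n s).symm ⟨S, (mem_powersetCard.mp hS).2⟩,
        mem_univ _, by simp⟩
  simp_rw [hL]
  rw [hS, ← prod_pow, prod_comm' (t' := univ)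
    (s' := fun j => {S ∈ powersetCard s (univ : Finset (Fin n)) | j ∈ S}) (by simp)]
  simp [card_filter_mem_powersetCard_univ hs]

section Field

variable {K : Type*} [Field K] [CharZero K] {n : ℕ}

/-- Conjugating by a diagonal matrix doubles the parameter of a transvection, so the determinant
of its compound matrix equals its own square. -/
theorem det_compound_transvection (s : ℕ) {i j : Fin n} (hij : i ≠ j) (c : K) :
    (compound s (transvection i j c)).det = 1 := by
  set d : Fin n → K := Function.update 1 i 2
  have hconj : diagonal d * transvection i j c =
      transvection i j c * transvection i j c * diagonal d := by
    rw [transvection_mul_transvection_same _ _ hij]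
    ext a b
    rw [diagonal_mul, mul_diagonal]
    by_cases ha : a = i <;> by_cases hb : b = j <;>
      simp [d, transvection, one_apply, single_apply, Function.update_apply] <;> grind
  have hd : (compound s (diagonal d)).det ≠ 0 := by
    rw [compound_diagonal, det_diagonal]
    refine prod_ne_zero_iff.mpr fun L _ => prod_ne_zero_iff.mpr fun k _ => ?_
    by_cases hk : L.1 k = i <;> simp [d, hk]
  have hinv : (compound s (transvection i j c)).det *
      (compound s (transvection i j (-c))).det = 1 := by
    rw [← det_mul, ← compound_mul, transvection_mul_transvection_same _ _ hij]
    simp [compound_one]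
  have hsq := congrArg (fun A => (compound s A).det) hconj
  simp only [compound_mul, det_mul] at hsq
  rw [mul_comm] at hsq
  have h := mul_right_cancel₀ hd hsq
  exact (mul_eq_left₀ (left_ne_zero_of_mul_eq_one hinv)).mp h.symm

theorem det_compound_of_field {s : ℕ} (hs : 1 ≤ s) (A : Matrix (Fin n) (Fin n) K) :
    (compound s A).det = A.det ^ (n - 1).choose (s - 1) := by
  induction A using diagonal_transvection_induction with
  | hdiag d _ => rw [compound_diagonal, det_diagonal, det_diagonal, prod_strictMono_prod hs]
  | htransvec t => rw [t.det, one_pow]; exact det_compound_transvection s t.hij t.c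
  | hmul A B hA hB => rw [compound_mul, det_mul, det_mul, hA, hB, mul_pow]

end Field

/-- Sylvester–Franke identity in matrix form: the determinant of the `s`-th compound matrix of
an `n×n` matrix `A` is `(det A)^(n−1 choose s−1)`. -/
theorem det_compound {R : Type*} [CommRing R] (n : ℕ) (A : Matrix (Fin n) (Fin n) R)
    (s : ℕ) (hs : 1 ≤ s) (hsn : s ≤ n) :
    (compound s A).det = A.det ^ Nat.choose (n - 1) (s - 1) := by
  have hX : (compound s (mvPolynomialX (Fin n) (Fin n) ℤ)).det =
      (mvPolynomialX (Fin n) (Fin n) ℤ).det ^ (n - 1).choose (s - 1) := by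
    let f := algebraMap (MvPolynomial (Fin n × Fin n) ℤ)
      (FractionRing (MvPolynomial (Fin n × Fin n) ℤ))
    apply IsFractionRing.injective (MvPolynomial (Fin n × Fin n) ℤ)
      (FractionRing (MvPolynomial (Fin n × Fin n) ℤ))
    change f _ = f _
    rw [map_pow, f.map_det, f.map_det, RingHom.mapMatrix_apply, RingHom.mapMatrix_apply,
      ← compound_map]
    exact det_compound_of_field hs _
  have h := congrArg (MvPolynomial.eval₂Hom (Int.castRingHom R) fun p => A p.1 p.2) hX
  rw [map_pow, RingHom.map_det, RingHom.map_det, RingHom.mapMatrix_apply,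
    RingHom.mapMatrix_apply, ← compound_map] at h
  rwa [MvPolynomial.coe_eval₂Hom, mvPolynomialX_map_eval₂] at h
end
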